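/- arXiv:1608.01641 — 2 statements merged into one kernel-verified Lean document; each statement's English description precedes it below -/
import Mathlib

section
/- The set (h ⊕ h*)^{W′,W′-reg} of points of h × h* whose stabilizer in W is exactly W′ is nonempty, path-connected, and simply connected. (It is the complement, inside the complex vector subspace of W′-fixed points of h × h*, of finitely many complex linear subspaces of complex codimension at least 2, namely the fixed-point subspaces of the subgroups of W strictly containing W′.) -/
noncomputable section

/-- The set `(𝔥 ⊕ 𝔥*)^{W′,W′-reg}` of points of `𝔥 × 𝔥*` whose stabilizer in `W` is exactly
`W′`, for the action `g·(v,f) = (g v, f ∘ g⁻¹)`.  Here `𝔥` is a finite-dimensional complex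
vector space with its Euclidean topology, `ρ` is a linear action of `W` on `𝔥`, and `𝔥*` is
the (continuous = algebraic) dual of `𝔥`. -/
def regularLocus (h : Type) [NormedAddCommGroup h] [NormedSpace ℂ h]
    (W : Type) [Group W] (ρ : Representation ℂ W h) (W' : Subgroup W) :
    Set (h × StrongDual ℂ h) :=
  {vf | ∀ g : W, (ρ g vf.1 = vf.1 ∧ ∀ u : h, vf.2 (ρ g⁻¹ u) = vf.2 u) ↔ g ∈ W'}

open Module in
/-- Points avoiding the cones over a smooth curve relative to finitely many small subspaces. -/
theorem exists_cone_point {E : Type*} [NormedAddCommGroup E] [NormedSpace ℝ E]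
    [FiniteDimensional ℝ E] {ι : Type*} [Finite ι] (V : ι → Submodule ℝ E)
    (hV : ∀ i, finrank ℝ (V i) + 3 ≤ finrank ℝ E) (γ : ℝ → E) (hγ : ContDiff ℝ 1 γ)
    (hE : 0 < finrank ℝ E) :
    ∃ c : E, ∀ i, ∀ s r : ℝ, ∀ v ∈ V i, v + r • γ s ≠ c := by
  let f : ∀ i, V i × ℝ × ℝ → E := fun i p => (p.1 : E) + p.2.1 • γ p.2.2
  have hf : ∀ i, ContDiff ℝ 1 (f i) := by
    intro i
    have h1 : ContDiff ℝ 1 (fun p : V i × ℝ × ℝ => (p.1 : E)) :=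
      (V i).subtypeL.contDiff.comp contDiff_fst
    have h2 : ContDiff ℝ 1 (fun p : V i × ℝ × ℝ => γ p.2.2) :=
      hγ.comp (contDiff_snd.comp contDiff_snd)
    have h3 : ContDiff ℝ 1 (fun p : V i × ℝ × ℝ => p.2.1) := contDiff_fst.comp contDiff_snd
    exact h1.add (h3.smul h2)
  have hd : dimH (⋃ i, Set.range (f i)) < finrank ℝ E := by
    rw [dimH_iUnion]
    have : ∀ i, dimH (Set.range (f i)) ≤ ((finrank ℝ E - 1 : ℕ) : ENNReal) := by
      intro i
      refine (hf i).dimH_range_le.trans ?_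
      have := hV i
      simp only [finrank_prod, finrank_self]
      exact_mod_cast (by omega)
    refine (iSup_le this).trans_lt ?_
    exact_mod_cast (by omega)
  obtain ⟨c, hc⟩ := (dense_compl_of_dimH_lt_finrank hd).nonempty
  refine ⟨c, fun i s r v hv h => hc ?_⟩
  exact Set.mem_iUnion.2 ⟨i, ⟨(⟨v, hv⟩, r, s), h⟩⟩

theorem segment_avoids {E : Type*} [AddCommGroup E] [Module ℝ E] (V : Submodule ℝ E) {c q : E}
    (hq : q ∉ V) (hc : ∀ r : ℝ, ∀ v ∈ V, v + r • q ≠ c) {a b : ℝ}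
    (hab : a + b = 1) : a • c + b • q ∉ V := by
  intro h
  by_cases ha : a = 0
  · subst ha
    obtain rfl : b = 1 := by linarith
    exact hq (by simpa using h)
  · refine hc (-(a⁻¹ * b)) _ (V.smul_mem a⁻¹ h) ?_
    rw [smul_add, smul_smul, smul_smul, inv_mul_cancel₀ ha, one_smul, neg_smul]
    abel

open Module unitInterval in
theorem isSimplyConnected_compl_submodules {E : Type*} [NormedAddCommGroup E] [NormedSpace ℝ E]
    [FiniteDimensional ℝ E] {ι : Type*} [Finite ι] (V : ι → Submodule ℝ E)
    (hV : ∀ i, finrank ℝ (V i) + 3 ≤ finrank ℝ E) :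
    IsSimplyConnected {x : E | ∀ i, x ∉ V i} := by
  rcases Nat.eq_zero_or_pos (finrank ℝ E) with h0 | hE
  · have hi : IsEmpty ι := ⟨fun i => by have := hV i; omega⟩
    have : {x : E | ∀ i, x ∉ V i} = Set.univ := by
      ext x; simp
    rw [this]
    have := (convex_univ (𝕜 := ℝ) (E := E)).contractibleSpace Set.univ_nonempty
    exact SimplyConnectedSpace.ofContractible _
  set U := {x : E | ∀ i, x ∉ V i} with hU
  have hopen : IsOpen U := by
    have : U = ⋂ i, ((V i : Set E))ᶜ := by ext x; simp [hU]
    rw [this]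
    exact isOpen_iInter_of_finite fun i => (V i).closed_of_finiteDimensional.isOpen_compl
  rw [isSimplyConnected_iff_exists_homotopy_refl_forall_mem]
  constructor
  · -- path-connected
    have key : ∀ x ∈ U, ∀ y ∈ U, JoinedIn U x y := by
      intro x hx y hy
      obtain ⟨c, hc⟩ := exists_cone_point V hV (fun t => x + t • (y - x)) (by fun_prop) hE
      have hcx : ∀ i, ∀ r : ℝ, ∀ v ∈ V i, v + r • x ≠ c := fun i r v hv => by
        simpa using hc i 0 r v hv
      have hcy : ∀ i, ∀ r : ℝ, ∀ v ∈ V i, v + r • y ≠ c := fun i r v hv => by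
        simpa using hc i 1 r v hv
      have jx : JoinedIn U c x := JoinedIn.of_segment_subset (by
        rintro _ ⟨a, b, -, -, hab, rfl⟩ i
        exact segment_avoids (V i) (hx i) (hcx i) hab)
      have jy : JoinedIn U c y := JoinedIn.of_segment_subset (by
        rintro _ ⟨a, b, -, -, hab, rfl⟩ i
        exact segment_avoids (V i) (hy i) (hcy i) hab)
      exact jx.symm.trans jy
    have hne : U.Nonempty := by
      obtain ⟨c, hc⟩ := exists_cone_point V hV (fun _ => 0) contDiff_const hE
      exact ⟨c, fun i hi => hc i 0 0 c hi (by simp)⟩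
    exact isPathConnected_iff.2 ⟨hne, key⟩
  · intro x p hp
    obtain ⟨ε, hε, hεU⟩ := (isCompact_range p.continuous).exists_thickening_subset_open hopen
      (Set.range_subset_iff.2 hp)
    obtain ⟨n, hn, hn0⟩ := ((Metric.tendsto_nhds.1 (bernsteinApproximation_uniform (p : C(I, E)))
      ε hε).and (Filter.eventually_ne_atTop 0)).exists
    let B := bernsteinApproximation n (p : C(I, E))
    have hB : ∀ t, dist (B t) (p t) < ε := fun t =>
      (ContinuousMap.dist_apply_le_dist t).trans_lt hn
    let q : Path x x :=
      { toContinuousMap := B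
        source' := by simp [B]
        target' := by simp [B, hn0] }
    have hball : ∀ t, Metric.ball (p t) ε ⊆ U := fun t =>
      (Metric.ball_subset_thickening (Set.mem_range_self t) ε).trans hεU
    have hqB : ∀ t, q t = B t := fun t => rfl
    have hqU : ∀ t, q t ∈ U := fun t => hball t (by simpa [hqB] using hB t)
    -- straight line homotopy
    let F₁ : p.Homotopy q :=
      { toFun := fun t => (1 - (t.1 : ℝ)) • p t.2 + (t.1 : ℝ) • q t.2
        continuous_toFun := by fun_prop
        map_zero_left := by simp
        map_one_left := by simp
        prop' := by
          rintro t s (rfl | rfl)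
          · simp [← add_smul]
          · simp [← add_smul] }
    have hF₁ : ∀ t, F₁ t ∈ U := by
      rintro ⟨t, s⟩
      refine hball s ?_
      exact (convex_ball (p s) ε) (Metric.mem_ball_self hε) (hB s) (by unit_interval)
        (by unit_interval) (by simp)
    -- the cone
    obtain ⟨g, hg, hgB⟩ : ∃ g : ℝ → E, ContDiff ℝ 1 g ∧ ∀ t : I, g t = B t := by
      refine ⟨fun s => ∑ k : Fin (n + 1),
        ((n.choose k : ℝ) * s ^ (k : ℕ) * (1 - s) ^ (n - k)) • p (bernstein.z k), ?_, ?_⟩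
      · refine ContDiff.sum fun k _ => ?_
        refine ContDiff.smul ?_ contDiff_const
        fun_prop
      · intro t
        simp [B, bernsteinApproximation.apply, bernstein_apply]
    obtain ⟨c, hc⟩ := exists_cone_point V hV g hg hE
    let S : Set E := {z | ∃ a b : ℝ, 0 ≤ a ∧ 0 ≤ b ∧ a + b = 1 ∧ ∃ t : I, z = a • c + b • q t}
    have hqS : ∀ t, q t ∈ S := fun t => ⟨0, 1, le_rfl, zero_le_one, by simp, t, by simp⟩
    have hSU : S ⊆ U := by
      rintro _ ⟨a, b, -, -, hab, t, rfl⟩ i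
      refine segment_avoids (V i) (hqU t i) (fun r v hv => ?_) hab
      have := hc i t r v hv
      rwa [hgB] at this
    have hSs : StarConvex ℝ c S := by
      rintro _ ⟨a, b, ha, hb, hab, t, rfl⟩ a' b' ha' hb' hab'
      refine ⟨a' + b' * a, b' * b, by positivity, by positivity, ?_, t, ?_⟩
      · rw [add_assoc, ← mul_add, hab, mul_one, hab']
      · rw [smul_add, smul_smul, smul_smul, add_smul, add_assoc]
    have hSc := hSs.contractibleSpace ⟨_, hqS 0⟩
    have hSS : IsSimplyConnected S := SimplyConnectedSpace.ofContractible _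
    obtain ⟨F₂, hF₂⟩ :=
      (isSimplyConnected_iff_exists_homotopy_refl_forall_mem.1 hSS).2 x q hqS
    refine ⟨F₁.trans F₂, fun t => ?_⟩
    rw [Path.Homotopy.trans_apply]
    split_ifs
    · exact hF₁ _
    · exact hSU (hF₂ _)

open Module in
theorem isSimplyConnected_compl_submodules_complex {E : Type*} [NormedAddCommGroup E]
    [NormedSpace ℂ E] [FiniteDimensional ℂ E] {ι : Type*} [Finite ι] (V : ι → Submodule ℂ E)
    (hV : ∀ i, ∃ x y : E, ∀ a b : ℂ, a • x + b • y ∈ V i → a = 0 ∧ b = 0) :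
    IsSimplyConnected {x : E | ∀ i, x ∉ V i} := by
  have : FiniteDimensional ℝ E := FiniteDimensional.complexToReal E
  refine isSimplyConnected_compl_submodules (fun i => (V i).restrictScalars ℝ) fun i => ?_
  have h1 : finrank ℝ ((V i).restrictScalars ℝ) = 2 * finrank ℂ (V i) :=
    finrank_real_of_complex (V i)
  have h2 : finrank ℝ E = 2 * finrank ℂ E := finrank_real_of_complex E
  have h3 := (V i).finrank_quotient_add_finrank
  have h4 : 2 ≤ finrank ℂ (E ⧸ V i) := by
    obtain ⟨x, y, h⟩ := hV i
    have hl : LinearIndependent ℂ ![(V i).mkQ x, (V i).mkQ y] := by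
      rw [LinearIndependent.pair_iff]
      intro a b hab
      refine h a b ?_
      rwa [← map_smul, ← map_smul, ← map_add, Submodule.mkQ_apply,
        Submodule.Quotient.mk_eq_zero] at hab
    simpa using hl.fintype_card_le_finrank
  omega

/-- Averaging operator over a subgroup. -/
theorem exists_average (h : Type) [AddCommGroup h] [Module ℂ h]
    (W : Type) [Group W] [Finite W] (ρ : Representation ℂ W h) (H : Subgroup W) :
    ∃ A : h →ₗ[ℂ] h, (∀ k ∈ H, ∀ u, ρ k (A u) = A u) ∧
      (∀ v, (∀ k ∈ H, ρ k v = v) → A v = v) ∧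
      (∀ (M : Type) [AddCommGroup M] [Module ℂ M] (f : h →ₗ[ℂ] M),
        (∀ k ∈ H, ∀ u, f (ρ k u) = f u) → ∀ u, f (A u) = f u) ∧
      (∀ k ∈ H, ∀ u, A (ρ k u) = A u) := by
  classical
  have := Fintype.ofFinite H
  have hc : (Fintype.card H : ℂ) ≠ 0 := by exact_mod_cast Fintype.card_ne_zero
  let A : h →ₗ[ℂ] h := (Fintype.card H : ℂ)⁻¹ • ∑ k : H, ρ k
  have hA : ∀ u, A u = (Fintype.card H : ℂ)⁻¹ • ∑ k : H, ρ k u := fun u => by simp [A]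
  refine ⟨A, ?_, ?_, ?_, ?_⟩
  · intro k hk u
    rw [hA, map_smul, map_sum]
    congr 1
    refine Fintype.sum_equiv (Equiv.mulLeft (⟨k, hk⟩ : H)) _ _ fun x => ?_
    simp [map_mul]
  · intro v hv
    rw [hA, Finset.sum_congr rfl fun k _ => hv k.1 k.2]
    simp [← Nat.cast_smul_eq_nsmul ℂ, smul_smul, hc]
  · intro M _ _ f hf u
    rw [hA, map_smul, map_sum, Finset.sum_congr rfl fun k _ => hf k.1 k.2 u]
    simp [← Nat.cast_smul_eq_nsmul ℂ, smul_smul, hc]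
  · intro k hk u
    rw [hA, hA]
    congr 1
    refine Fintype.sum_equiv (Equiv.mulRight (⟨k, hk⟩ : H)) _ _ fun x => ?_
    simp [map_mul]

/-- Stabilizer of a vector. -/
def vecStab {h : Type} [AddCommGroup h] [Module ℂ h]
    {W : Type} [Group W] (ρ : Representation ℂ W h) (v : h) : Subgroup W where
  carrier := {g | ρ g v = v}
  one_mem' := by simp
  mul_mem' := by
    intro a b ha hb
    simp only [Set.mem_ofPred_eq] at *
    rw [map_mul, Module.End.mul_apply, hb, ha]
  inv_mem' := by
    intro a ha
    simp only [Set.mem_ofPred_eq] at *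
    conv_lhs => rw [← ha]
    simp

/-- Stabilizer of a functional. -/
def funStab {h : Type} [AddCommGroup h] [Module ℂ h]
    {W : Type} [Group W] (ρ : Representation ℂ W h) (f : h →ₗ[ℂ] ℂ) : Subgroup W where
  carrier := {g | ∀ u, f (ρ g u) = f u}
  one_mem' := by simp
  mul_mem' := by
    intro a b ha hb u
    rw [map_mul, Module.End.mul_apply, ha, hb]
  inv_mem' := by
    intro a ha u
    rw [← ha]
    simp

theorem exists_functional {h : Type} [AddCommGroup h] [Module ℂ h]
    {W : Type} [Group W] [Finite W] (ρ : Representation ℂ W h) (W' : Subgroup W) (g : W)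
    (v : h) (hv : W' ≤ vecStab ρ v) (hg : g ∉ vecStab ρ v) :
    ∃ f : h →ₗ[ℂ] ℂ, W' ≤ funStab ρ f ∧ g ∉ funStab ρ f := by
  set H := W' ⊔ Subgroup.zpowers g with hH
  have hWH : W' ≤ H := le_sup_left
  have hgH : g ∈ H := (le_sup_right : _ ≤ H) (Subgroup.mem_zpowers g)
  obtain ⟨A, a1, a2, a3, a4⟩ := exists_average h W ρ H
  obtain ⟨P, p1, p2, p3, p4⟩ := exists_average h W ρ W'
  have hne : v - A v ≠ 0 := by
    intro h0
    apply hg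
    have : A v = v := (sub_eq_zero.1 h0).symm
    change ρ g v = v
    rw [← this]
    exact a1 g hgH v
  obtain ⟨φ, hφ⟩ : ∃ φ : Module.Dual ℂ h, φ (v - A v) ≠ 0 := by
    by_contra! hcon
    exact hne ((Module.forall_dual_apply_eq_zero_iff ℂ _).1 hcon)
  refine ⟨φ ∘ₗ P, fun k hk u => ?_, fun hgf => hφ ?_⟩
  · simp [p4 k hk]
  · have hle : H ≤ funStab ρ (φ ∘ₗ P) :=
      sup_le (fun k hk u => by simp [p4 k hk]) ((Subgroup.zpowers_le).2 hgf)
    have e1 := a3 ℂ (φ ∘ₗ P) (fun k hk => hle hk) v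
    have e2 : P (v - A v) = v - A v := p2 _ fun k hk => by
      rw [map_sub, a1 k (hWH hk), (show ρ k v = v from hv hk)]
    rw [← e2, map_sub, map_sub]
    simp only [LinearMap.comp_apply] at e1
    rw [e1, sub_self]

theorem exists_vector {h : Type} [AddCommGroup h] [Module ℂ h]
    {W : Type} [Group W] [Finite W] (ρ : Representation ℂ W h) (W' : Subgroup W) (g : W)
    (f : h →ₗ[ℂ] ℂ) (hf : W' ≤ funStab ρ f) (hg : g ∉ funStab ρ f) :
    ∃ v : h, W' ≤ vecStab ρ v ∧ g ∉ vecStab ρ v := by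
  set H := W' ⊔ Subgroup.zpowers g with hH
  have hWH : W' ≤ H := le_sup_left
  have hgH : g ∈ H := (le_sup_right : _ ≤ H) (Subgroup.mem_zpowers g)
  obtain ⟨A, a1, a2, a3, a4⟩ := exists_average h W ρ H
  obtain ⟨P, p1, p2, p3, p4⟩ := exists_average h W ρ W'
  obtain ⟨u, hu⟩ : ∃ u, f (A u) ≠ f u := by
    by_contra! hcon
    apply hg
    intro u
    rw [← hcon (ρ g u), a4 g hgH, hcon]
  refine ⟨P u, fun k hk => p1 k hk u, fun hgv => hu ?_⟩
  have hle : H ≤ vecStab ρ (P u) :=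
    sup_le (fun k hk => p1 k hk u) ((Subgroup.zpowers_le).2 hgv)
  have e1 : A (P u) = P u := a2 _ fun k hk => hle hk
  have e2 : A (P u) = A u := p3 h A (fun k hk => a4 k (hWH hk)) u
  rw [← e2, e1, p3 ℂ f (fun k hk => hf hk)]

/-- The subspace of points fixed by `g`. -/
def fixSub (h : Type) [NormedAddCommGroup h] [NormedSpace ℂ h]
    (W : Type) [Group W] (ρ : Representation ℂ W h) (g : W) :
    Submodule ℂ (h × StrongDual ℂ h) where
  carrier := {vf | ρ g vf.1 = vf.1 ∧ ∀ u : h, vf.2 (ρ g⁻¹ u) = vf.2 u}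
  zero_mem' := by simp
  add_mem' := by
    rintro x y ⟨h1, h2⟩ ⟨h3, h4⟩
    exact ⟨by simp [h1, h3], fun u => by simp [h2, h4]⟩
  smul_mem' := by
    rintro c x ⟨h1, h2⟩
    exact ⟨by simp [h1], fun u => by simp [h2]⟩

theorem mem_fixSub (h : Type) [NormedAddCommGroup h] [NormedSpace ℂ h]
    (W : Type) [Group W] (ρ : Representation ℂ W h) (g : W) (x : h × StrongDual ℂ h) :
    x ∈ fixSub h W ρ g ↔
      g ∈ vecStab ρ x.1 ∧ g ∈ funStab ρ (x.2 : h →ₗ[ℂ] ℂ) := by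
  rw [← inv_mem_iff (H := funStab ρ (x.2 : h →ₗ[ℂ] ℂ))]
  rfl

/-- If `W′` is a parabolic subgroup of the finite group `W` (the stabilizer of some point of
`𝔥 × 𝔥*`), then `(𝔥 ⊕ 𝔥*)^{W′,W′-reg}` is nonempty, path-connected and simply connected. -/
theorem regularLocus_simplyConnected
    (h : Type) [NormedAddCommGroup h] [NormedSpace ℂ h] [FiniteDimensional ℂ h]
    (W : Type) [Group W] [Finite W] (ρ : Representation ℂ W h) (W' : Subgroup W)
    (hpar : ∃ vf : h × StrongDual ℂ h, vf ∈ regularLocus h W ρ W') :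
    (regularLocus h W ρ W').Nonempty ∧
      IsPathConnected (regularLocus h W ρ W') ∧
      SimplyConnectedSpace (regularLocus h W ρ W') := by
  suffices hs : IsSimplyConnected (regularLocus h W ρ W') from
    ⟨hpar, hs.isPathConnected, hs⟩
  obtain ⟨p, hp⟩ := hpar
  let E : Submodule ℂ (h × StrongDual ℂ h) := ⨅ g : W', fixSub h W ρ g
  have hE : ∀ x, x ∈ E ↔ ∀ g ∈ W', x ∈ fixSub h W ρ g := fun x => by
    simp [E, Submodule.mem_iInf]
  let V : {g : W // g ∉ W'} → Submodule ℂ E := fun g => (fixSub h W ρ g).comap E.subtype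
  have himg : regularLocus h W ρ W' = ((↑) : E → _) '' {x : E | ∀ i, x ∉ V i} := by
    ext x
    constructor
    · intro hx
      exact ⟨⟨x, (hE x).2 fun g hg => (hx g).2 hg⟩, fun i hi => i.2 ((hx i).1 hi), rfl⟩
    · rintro ⟨⟨x, hxE⟩, hx, rfl⟩ g
      refine ⟨fun hg => ?_, fun hg => (hE x).1 hxE g hg⟩
      by_contra hgW
      exact hx ⟨g, hgW⟩ hg
  rw [himg, Topology.IsEmbedding.subtypeVal.isSimplyConnected_image]
  refine isSimplyConnected_compl_submodules_complex (E := E) V fun i => ?_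
  obtain ⟨g, hg⟩ := i
  have hpg : ¬ (g ∈ vecStab ρ p.1 ∧ g ∈ funStab ρ (p.2 : h →ₗ[ℂ] ℂ)) := by
    rw [← mem_fixSub]
    exact fun hh => hg ((hp g).1 hh)
  have hpW : ∀ k ∈ W', k ∈ vecStab ρ p.1 ∧ k ∈ funStab ρ (p.2 : h →ₗ[ℂ] ℂ) := fun k hk => by
    rw [← mem_fixSub]
    exact (hp k).2 hk
  obtain ⟨v, f, hv, hgv, hf, hgf⟩ : ∃ (v : h) (f : h →ₗ[ℂ] ℂ), W' ≤ vecStab ρ v ∧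
      g ∉ vecStab ρ v ∧ W' ≤ funStab ρ f ∧ g ∉ funStab ρ f := by
    by_cases h1 : g ∈ vecStab ρ p.1
    · have h2 : g ∉ funStab ρ (p.2 : h →ₗ[ℂ] ℂ) := fun h2 => hpg ⟨h1, h2⟩
      obtain ⟨v, hv, hgv⟩ := exists_vector ρ W' g _ (fun k hk => (hpW k hk).2) h2
      exact ⟨v, _, hv, hgv, fun k hk => (hpW k hk).2, h2⟩
    · obtain ⟨f, hf, hgf⟩ := exists_functional ρ W' g _ (fun k hk => (hpW k hk).1) h1
      exact ⟨_, f, fun k hk => (hpW k hk).1, h1, hf, hgf⟩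
  let f' : StrongDual ℂ h := LinearMap.toContinuousLinearMap f
  have hf' : (f' : h →ₗ[ℂ] ℂ) = f := by ext; simp [f']
  have hvE : ((v, 0) : h × StrongDual ℂ h) ∈ E := (hE _).2 fun k hk =>
    (mem_fixSub ..).2 ⟨hv hk, fun u => by simp⟩
  have hfE : ((0, f') : h × StrongDual ℂ h) ∈ E := (hE _).2 fun k hk =>
    (mem_fixSub ..).2 ⟨map_zero _, by rw [hf']; exact hf hk⟩
  refine ⟨⟨_, hvE⟩, ⟨_, hfE⟩, fun a b hab => ?_⟩
  have hab' : a • ((v, 0) : h × StrongDual ℂ h) + b • ((0, f') : h × StrongDual ℂ h) ∈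
      fixSub h W ρ g := hab
  rw [mem_fixSub] at hab'
  obtain ⟨h1, h2⟩ := hab'
  constructor
  · by_contra ha
    apply hgv
    have h3 : ρ g (a • v + b • 0) = a • v + b • 0 := h1
    rw [smul_zero, add_zero, map_smul] at h3
    exact smul_right_injective h ha h3
  · by_contra hb
    apply hgf
    intro u
    have h3 := h2 u
    simpa [f', hb] using h3
end
end

section
/- The normalizer N_W(W′) preserves the set (h ⊕ h*)^{W′,W′-reg}, the subgroup W′ acts trivially on it, the induced action of the finite group N_W(W′)/W′ on it is free, and the fundamental group of the orbit space (h ⊕ h*)^{W′,W′-reg} / N_W(W′) (at any basepoint) is isomorphic to the group N_W(W′)/W′. In particular this fundamental group is finite. -/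
noncomputable section

/-- The action of `g ∈ W` on `𝔥 × 𝔥*`: `g·(v,f) = (g v, f ∘ g⁻¹)`. -/
def dualPairAction (h : Type) [NormedAddCommGroup h] [NormedSpace ℂ h]
    [FiniteDimensional ℂ h] (W : Type) [Group W] (ρ : Representation ℂ W h) (g : W) :
    h × StrongDual ℂ h → h × StrongDual ℂ h :=
  fun vf => (ρ g vf.1, vf.2.comp (LinearMap.toContinuousLinearMap (ρ g⁻¹)))

/-- The orbit relation of the normalizer `N_W(W′)` on the regular locus. -/
def normalizerOrbitRel (h : Type) [NormedAddCommGroup h] [NormedSpace ℂ h]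
    [FiniteDimensional ℂ h] (W : Type) [Group W] (ρ : Representation ℂ W h)
    (W' : Subgroup W) :
    ↥(regularLocus h W ρ W') → ↥(regularLocus h W ρ W') → Prop :=
  fun a b => ∃ g ∈ Subgroup.normalizer (W' : Set W), dualPairAction h W ρ g (a : h × StrongDual ℂ h) = b

namespace LeafAux

open Topology Filter unitInterval

section Top

variable {V : Type*} [NormedAddCommGroup V] [NormedSpace ℝ V]

/-- Two paths in `U` with values in a convex subset `K ⊆ U` are homotopic in `U`. -/
lemma homotopic_of_convex {U K : Set V} (hK : Convex ℝ K) (hKU : K ⊆ U) {x y : U}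
    (p q : Path x y) (hp : ∀ t, (p t : V) ∈ K) (hq : ∀ t, (q t : V) ∈ K) :
    p.Homotopic q := by
  refine ⟨{
    toFun := fun s => ⟨(1 - (s.1 : ℝ)) • (p s.2 : V) + (s.1 : ℝ) • (q s.2 : V), hKU ?_⟩
    continuous_toFun := ?_
    map_zero_left := ?_
    map_one_left := ?_
    prop' := ?_ }⟩
  · exact hK (hp _) (hq _) (sub_nonneg.2 s.1.2.2) s.1.2.1 (by ring)
  · refine Continuous.subtype_mk ?_ _
    fun_prop
  · intro t; ext; simp
  · intro t; ext; simp
  · intro t s hs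
    rcases hs with rfl | rfl
    · ext; simp [← add_smul]
    · ext; simp [← add_smul]

/-- The straight path inside `U`. -/
def segU {U : Set V} (x y : U) (h : segment ℝ (x : V) y ⊆ U) : Path x y where
  toFun t := ⟨AffineMap.lineMap (x : V) (y : V) (t : ℝ), h (by
    rw [segment_eq_image_lineMap]; exact ⟨t, t.2, rfl⟩)⟩
  continuous_toFun := by
    refine Continuous.subtype_mk ?_ _
    simp only [AffineMap.lineMap_apply]
    fun_prop
  source' := by ext; simp
  target' := by ext; simp

lemma segU_mem {U : Set V} (x y : U) (h : segment ℝ (x : V) y ⊆ U) (t : I) :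
    (segU x y h t : V) ∈ segment ℝ (x : V) y := by
  rw [segment_eq_image_lineMap]; exact ⟨t, t.2, rfl⟩

/-- Complement of a family of subspaces. -/
def compl {ι : Type*} (S : ι → Submodule ℝ V) : Set V := {c | ∀ i, c ∉ S i}

variable [FiniteDimensional ℝ V]

lemma residual_compl_submodule (T : Submodule ℝ V) (hT : T ≠ ⊤) :
    ∀ᶠ c in residual V, c ∉ T := by
  refine residual_of_dense_open (s := (T : Set V)ᶜ) ?_ ?_
  · exact T.closed_of_finiteDimensional.isOpen_compl
  · rw [← interior_eq_empty_iff_dense_compl]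
    by_contra h
    exact hT (T.eq_top_of_nonempty_interior' (Set.nonempty_iff_ne_empty.2 h))

variable {ι : Type*} [Finite ι] (S : ι → Submodule ℝ V)

lemma triangle_subset {x y c : V} (hxy : segment ℝ x y ⊆ compl S)
    (hc : ∀ i, c ∉ S i ⊔ Submodule.span ℝ {x, y}) :
    convexHull ℝ {x, y, c} ⊆ compl S := by
  intro z hz i hzi
  have : ({x, y, c} : Set V) = insert c {x, y} := by
    ext; simp; tauto
  rw [this, convexHull_insert (by simp), convexHull_pair, mem_convexJoin] at hz
  obtain ⟨c', hc', w, hw, hz⟩ := hz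
  rw [Set.mem_singleton_iff] at hc'
  subst hc'
  obtain ⟨a, b, ha, hb, hab, rfl⟩ := hz
  by_cases h0 : a = 0
  · subst h0
    have : b = 1 := by linarith
    subst this
    simp only [zero_smul, one_smul, zero_add] at hzi
    exact hxy hw i hzi
  · apply hc i
    have hws : w ∈ Submodule.span ℝ ({x, y} : Set V) := by
      obtain ⟨a', b', -, -, -, rfl⟩ := hw
      exact add_mem (Submodule.smul_mem _ _ (Submodule.subset_span (by simp)))
        (Submodule.smul_mem _ _ (Submodule.subset_span (by simp)))
    have : c' = a⁻¹ • ((a • c' + b • w) - b • w) := by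
      simp [smul_smul, h0]
    rw [this]
    exact Submodule.smul_mem _ _ (sub_mem (Submodule.mem_sup_left hzi)
      (Submodule.mem_sup_right (Submodule.smul_mem _ _ hws)))

lemma eventually_triangle
    (hS : ∀ i, ∀ x y : V, S i ⊔ Submodule.span ℝ {x, y} ≠ ⊤) {x y : V} (hxy : segment ℝ x y ⊆ compl S) :
    ∀ᶠ c in residual V, convexHull ℝ {x, y, c} ⊆ compl S := by
  have : ∀ᶠ c in residual V, ∀ i, c ∉ S i ⊔ Submodule.span ℝ {x, y} :=
    eventually_all.2 fun i => residual_compl_submodule _ (hS i x y)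
  filter_upwards [this] with c hc
  exact triangle_subset S hxy hc

lemma eventually_segment
    (hS : ∀ i, ∀ x y : V, S i ⊔ Submodule.span ℝ {x, y} ≠ ⊤) (x : compl S) :
    ∀ᶠ c in residual V, segment ℝ (x : V) c ⊆ compl S := by
  filter_upwards [eventually_triangle S hS (x := (x : V)) (y := x)
    (by simp)] with c hc
  refine subset_trans ?_ hc
  exact segment_subset_convexHull (by simp) (by simp)

/-- A path is generically equal to the broken line through a generic point. -/
def Good {x y : compl S} (γ : Path x y) : Prop :=
  ∀ᶠ c in residual V, ∀ (hc : c ∈ compl S) (hx : segment ℝ (x : V) c ⊆ compl S)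
    (hy : segment ℝ (y : V) c ⊆ compl S),
    γ.Homotopic ((segU x ⟨c, hc⟩ hx).trans (segU y ⟨c, hc⟩ hy).symm)

lemma good_of_convex
    (hS : ∀ i, ∀ x y : V, S i ⊔ Submodule.span ℝ {x, y} ≠ ⊤) {x y : compl S} (γ : Path x y) {K : Set V} (hK : Convex ℝ K)
    (hKU : K ⊆ compl S) (hγ : ∀ t, (γ t : V) ∈ K) : Good S γ := by
  have hx : (x : V) ∈ K := by simpa using hγ 0
  have hy : (y : V) ∈ K := by simpa using hγ 1
  have hxy : segment ℝ (x : V) y ⊆ compl S := (hK.segment_subset hx hy).trans hKU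
  filter_upwards [eventually_triangle S hS hxy] with c hcc hc h1 h2
  have e1 : γ.Homotopic (segU x y hxy) :=
    homotopic_of_convex hK hKU _ _ hγ fun t => hK.segment_subset hx hy (segU_mem _ _ _ _)
  refine e1.trans (homotopic_of_convex (convex_convexHull ℝ _) hcc _ _ (fun t => ?_) fun t => ?_)
  · exact segment_subset_convexHull (by simp) (by simp) (segU_mem _ _ _ t)
  · rw [Path.trans_apply]
    split_ifs
    · exact segment_subset_convexHull (by simp) (by simp) (segU_mem x ⟨c, hc⟩ h1 _)
    · exact segment_subset_convexHull (by simp) (by simp) (segU_mem y ⟨c, hc⟩ h2 _)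

lemma Good.trans'
    (hS : ∀ i, ∀ x y : V, S i ⊔ Submodule.span ℝ {x, y} ≠ ⊤) {x y z : compl S} {γ : Path x y} {γ' : Path y z} {δ : Path x z}
    (h : Good S γ) (h' : Good S γ') (hd : (γ.trans γ').Homotopic δ) : Good S δ := by
  filter_upwards [h, h', eventually_segment S hS y] with c h1 h2 hy hc hx hz
  have a := h1 hc hx hy
  have b := h2 hc hy hz
  have ab := hd.symm.trans (a.hcomp b)
  rw [← Path.Homotopic.Quotient.eq] at ab ⊢
  rw [ab]
  simp only [Path.Homotopic.Quotient.mk_trans, Path.Homotopic.Quotient.mk_symm,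
    Path.Homotopic.Quotient.trans_assoc]
  congr 1
  rw [← Path.Homotopic.Quotient.trans_assoc, Path.Homotopic.Quotient.symm_trans,
    Path.Homotopic.Quotient.refl_trans]

lemma good_all
    (hS : ∀ i, ∀ x y : V, S i ⊔ Submodule.span ℝ {x, y} ≠ ⊤) {x y : compl S} (γ : Path x y) : Good S γ := by
  have key : ∀ s t : I, Good S (γ.subpath s t) := by
    refine PreconnectedSpace.induction₂' _ (fun s => ?_) ⟨fun a b c h1 h2 =>
      Good.trans' S hS h1 h2 ⟨Path.Homotopy.subpathTransSubpath γ a b c⟩⟩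
    have hopen : IsOpen (compl S) := by
      have : compl S = ⋂ i, ((S i : Set V))ᶜ := by ext; simp [compl]
      rw [this]
      exact isOpen_iInter_of_finite fun i => (S i).closed_of_finiteDimensional.isOpen_compl
    obtain ⟨ε, hε, hb⟩ := Metric.isOpen_iff.1 hopen _ (γ s).2
    have hcont : Continuous fun t => (γ t : V) := by fun_prop
    obtain ⟨δ, hδ, hd⟩ := Metric.continuous_iff.1 hcont s ε hε
    filter_upwards [Metric.ball_mem_nhds s hδ] with t ht
    have hmem : ∀ r ∈ Set.uIcc s t, (γ r : V) ∈ Metric.ball (γ s : V) ε := by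
      intro r hr
      apply hd
      refine lt_of_le_of_lt ?_ ht
      rw [Subtype.dist_eq, Subtype.dist_eq, Real.dist_eq, Real.dist_eq]
      have : (r : ℝ) ∈ Set.uIcc (s : ℝ) t := by
        rcases le_total s t with h | h
        · rw [Set.uIcc_of_le h] at hr
          rw [Set.uIcc_of_le (by exact_mod_cast h)]
          exact ⟨hr.1, hr.2⟩
        · rw [Set.uIcc_of_ge h] at hr
          rw [Set.uIcc_of_ge (by exact_mod_cast h)]
          exact ⟨hr.1, hr.2⟩
      exact Set.abs_sub_left_of_mem_uIcc this
    constructor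
    · refine good_of_convex S hS _ (convex_ball (γ s : V) ε) hb fun r => ?_
      have : γ.subpath s t r ∈ Set.range (γ.subpath s t) := ⟨r, rfl⟩
      rw [Path.range_subpath] at this
      obtain ⟨r', hr', h⟩ := this
      rw [← h]; exact hmem _ hr'
    · refine good_of_convex S hS _ (convex_ball (γ s : V) ε) hb fun r => ?_
      have : γ.subpath t s r ∈ Set.range (γ.subpath t s) := ⟨r, rfl⟩
      rw [Path.range_subpath, Set.uIcc_comm] at this
      obtain ⟨r', hr', h⟩ := this
      rw [← h]; exact hmem _ hr'
  have h := key 0 1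
  filter_upwards [h] with c h1 hc hx hy
  have := h1 hc (by simpa using hx) (by simpa using hy)
  have h2 := this.pathCast γ.source.symm γ.target.symm
  have e1 : (γ.subpath 0 1).cast γ.source.symm γ.target.symm = γ := by ext; simp
  rw [e1] at h2
  refine h2.trans ?_
  rw [show Path.cast _ _ _ = (segU x ⟨c, hc⟩ hx).trans (segU y ⟨c, hc⟩ hy).symm from ?_]
  ext t
  simp [Path.trans_apply, segU]

theorem simplyConnected_compl
    (hS : ∀ i, ∀ x y : V, S i ⊔ Submodule.span ℝ {x, y} ≠ ⊤) : IsSimplyConnected (compl S) := by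
  have hex : ∀ {p : V → Prop}, (∀ᶠ c in residual V, p c) → ∃ c, p c := fun h =>
    (dense_of_mem_residual h).nonempty
  rw [IsSimplyConnected, simply_connected_iff_paths_homotopic']
  refine ⟨⟨?_, fun x y => ?_⟩, fun {x y} p q => ?_⟩
  · obtain ⟨c, hc⟩ := hex (p := fun c => ∀ i, c ∉ S i ⊔ Submodule.span ℝ {(0 : V), 0})
      (eventually_all.2 fun i => residual_compl_submodule _ (hS i 0 0))
    exact ⟨⟨c, fun i hi => hc i (Submodule.mem_sup_left hi)⟩⟩
  · obtain ⟨c, hx, hy⟩ := hex ((eventually_segment S hS x).and (eventually_segment S hS y))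
    have hc : c ∈ compl S := hx (right_mem_segment ℝ _ _)
    exact ⟨(segU x ⟨c, hc⟩ hx).trans (segU y ⟨c, hc⟩ hy).symm⟩
  · obtain ⟨c, ⟨hx, hy⟩, h1, h2⟩ := hex (((eventually_segment S hS x).and
      (eventually_segment S hS y)).and ((good_all S hS p).and (good_all S hS q)))
    have hc : c ∈ compl S := hx (right_mem_segment ℝ _ _)
    exact (h1 hc hx hy).trans (h2 hc hx hy).symm

end Top

section Alg

variable {W : Type*} [Group W] [Finite W] {M : Type*} [Ring M] [Algebra ℂ M]

attribute [local instance] Fintype.ofFinite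

/-- Sum over a subgroup. -/
def sumSub (φ : W →* M) (H : Subgroup W) : M := ∑ w : H, φ w

lemma mul_sumSub (φ : W →* M) (H : Subgroup W) {g : W} (hg : g ∈ H) :
    φ g * sumSub φ H = sumSub φ H := by
  rw [sumSub, Finset.mul_sum]
  refine Fintype.sum_equiv (Equiv.mulLeft (⟨g, hg⟩ : H)) _ _ fun w => ?_
  simp

lemma sumSub_mul (φ : W →* M) (H : Subgroup W) {g : W} (hg : g ∈ H) :
    sumSub φ H * φ g = sumSub φ H := by
  rw [sumSub, Finset.sum_mul]
  refine Fintype.sum_equiv (Equiv.mulRight (⟨g, hg⟩ : H)) _ _ fun w => ?_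
  simp

lemma nsmul_inj {M : Type*} [AddCommGroup M] [Module ℂ M] {n : ℕ} (hn : n ≠ 0) {a b : M}
    (h : n • a = n • b) : a = b := by
  rw [← Nat.cast_smul_eq_nsmul ℂ, ← Nat.cast_smul_eq_nsmul ℂ] at h
  exact smul_right_injective M (r := (n : ℂ)) (by exact_mod_cast hn) h

lemma left_of_right (φ : W →* M) (H : Subgroup W) {g : W}
    (hg : sumSub φ H * φ g = sumSub φ H) : φ g * sumSub φ H = sumSub φ H := by
  set K : Subgroup W := H ⊔ Subgroup.zpowers g with hKdef
  have hgK : g ∈ K := Subgroup.mem_sup_right (Subgroup.mem_zpowers g)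
  let T : Subgroup W :=
    { carrier := {w | sumSub φ H * φ w = sumSub φ H}
      mul_mem' := by
        intro a b ha hb
        simp only [Set.mem_ofPred_eq] at *
        rw [map_mul, ← mul_assoc, ha, hb]
      one_mem' := by simp
      inv_mem' := by
        intro a ha
        simp only [Set.mem_ofPred_eq] at *
        conv_lhs => rw [← ha]
        rw [mul_assoc, ← map_mul]; simp }
  have hKT : K ≤ T := sup_le (fun w hw => sumSub_mul φ H hw)
    ((Subgroup.zpowers_le).2 hg)
  have e1 : sumSub φ H * sumSub φ K = Fintype.card K • sumSub φ H := by
    conv_lhs => rw [sumSub.eq_1 φ K]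
    rw [Finset.mul_sum, Finset.sum_congr rfl (fun w _ => hKT w.2)]
    simp
  have e2 : sumSub φ H * sumSub φ K = Fintype.card H • sumSub φ K := by
    conv_lhs => rw [sumSub.eq_1 φ H]
    rw [Finset.sum_mul, Finset.sum_congr rfl
      (fun w _ => mul_sumSub φ K (Subgroup.mem_sup_left w.2))]
    simp
  refine nsmul_inj (n := Fintype.card K) Fintype.card_ne_zero ?_
  rw [← mul_smul_comm, ← e1, e2, mul_smul_comm, mul_sumSub φ K hgK]

lemma right_of_left (φ : W →* M) (H : Subgroup W) {g : W}
    (hg : φ g * sumSub φ H = sumSub φ H) : sumSub φ H * φ g = sumSub φ H := by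
  set K : Subgroup W := H ⊔ Subgroup.zpowers g with hKdef
  have hgK : g ∈ K := Subgroup.mem_sup_right (Subgroup.mem_zpowers g)
  let T : Subgroup W :=
    { carrier := {w | φ w * sumSub φ H = sumSub φ H}
      mul_mem' := by
        intro a b ha hb
        simp only [Set.mem_ofPred_eq] at *
        rw [map_mul, mul_assoc, hb, ha]
      one_mem' := by simp
      inv_mem' := by
        intro a ha
        simp only [Set.mem_ofPred_eq] at *
        conv_lhs => rw [← ha]
        rw [← mul_assoc, ← map_mul]; simp }
  have hKT : K ≤ T := sup_le (fun w hw => mul_sumSub φ H hw)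
    ((Subgroup.zpowers_le).2 hg)
  have e1 : sumSub φ K * sumSub φ H = Fintype.card K • sumSub φ H := by
    conv_lhs => rw [sumSub.eq_1 φ K]
    rw [Finset.sum_mul, Finset.sum_congr rfl (fun w _ => hKT w.2)]
    simp
  have e2 : sumSub φ K * sumSub φ H = Fintype.card H • sumSub φ K := by
    conv_lhs => rw [sumSub.eq_1 φ H]
    rw [Finset.mul_sum, Finset.sum_congr rfl
      (fun w _ => sumSub_mul φ K (Subgroup.mem_sup_left w.2))]
    simp
  refine nsmul_inj (n := Fintype.card K) Fintype.card_ne_zero ?_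
  rw [← smul_mul_assoc, ← e1, e2, smul_mul_assoc, sumSub_mul φ K hgK]

end Alg

section Rep

attribute [local instance] Fintype.ofFinite

variable {h : Type} [NormedAddCommGroup h] [NormedSpace ℂ h] [FiniteDimensional ℂ h]
  {W : Type} [Group W] (ρ : Representation ℂ W h) (W' : Subgroup W)

lemma act_mul (a b : W) (p : h × StrongDual ℂ h) :
    dualPairAction h W ρ (a * b) p = dualPairAction h W ρ a (dualPairAction h W ρ b p) := by
  refine Prod.ext ?_ ?_
  · simp [dualPairAction]
  · ext u; simp [dualPairAction]

lemma act_one (p : h × StrongDual ℂ h) : dualPairAction h W ρ 1 p = p := by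
  refine Prod.ext ?_ ?_
  · simp [dualPairAction]
  · ext u; simp [dualPairAction]

lemma act_eq_iff (g : W) (p : h × StrongDual ℂ h) :
    dualPairAction h W ρ g p = p ↔ (ρ g p.1 = p.1 ∧ ∀ u : h, p.2 (ρ g⁻¹ u) = p.2 u) := by
  rw [Prod.ext_iff, ContinuousLinearMap.ext_iff]
  rfl

lemma mem_reg_iff (p : h × StrongDual ℂ h) :
    p ∈ regularLocus h W ρ W' ↔ ∀ g, dualPairAction h W ρ g p = p ↔ g ∈ W' := by
  simp only [act_eq_iff]; rfl

lemma act_continuous (g : W) : Continuous (dualPairAction h W ρ g) := by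
  unfold dualPairAction
  have : Continuous (ρ g : h → h) := (ρ g).continuous_of_finiteDimensional
  fun_prop

lemma act_mem {g : W} (hg : g ∈ Subgroup.normalizer (W' : Set W)) {p : h × StrongDual ℂ h}
    (hp : p ∈ regularLocus h W ρ W') : dualPairAction h W ρ g p ∈ regularLocus h W ρ W' := by
  rw [mem_reg_iff] at hp ⊢
  intro k
  have h1 : k ∈ W' ↔ g⁻¹ * k * g ∈ W' := Subgroup.mem_normalizer_iff''.1 hg k
  rw [h1, ← hp]
  constructor
  · intro e
    rw [act_mul, act_mul, e, ← act_mul]; simp [act_one]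
  · intro e
    conv_rhs => rw [← e]
    rw [← act_mul, ← act_mul]; congr 1; group

/-- The fixed space of the subgroup. -/
def fixedSpace : Submodule ℂ (h × StrongDual ℂ h) where
  carrier := {p | ∀ w ∈ W', ρ w p.1 = p.1 ∧ ∀ u : h, p.2 (ρ w⁻¹ u) = p.2 u}
  add_mem' := by
    intro a b ha hb w hw
    have := ha w hw
    have := hb w hw
    simp_all
  zero_mem' := by simp
  smul_mem' := by
    intro c a ha w hw
    have := ha w hw
    simp_all

/-- The real module structure on the fixed space. -/
instance (priority := 2000) fixedModule : Module ℝ (fixedSpace ρ W') :=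
  (NormedSpace.complexToReal : NormedSpace ℝ (fixedSpace ρ W')).toModule

/-- The points of the fixed space also fixed by `g`. -/
def badSpace (g : {g : W // g ∉ W'}) : Submodule ℝ (fixedSpace ρ W') where
  carrier := {p | ρ g.1 p.1.1 = p.1.1 ∧ ∀ u : h, p.1.2 (ρ g.1⁻¹ u) = p.1.2 u}
  add_mem' := by
    intro a b ha hb
    simp_all
  zero_mem' := by simp
  smul_mem' := by
    intro c a ha
    have h1 : ((c • a : fixedSpace ρ W') : h × StrongDual ℂ h) = (c : ℂ) • a.1 := rfl
    simp only [Set.mem_ofPred_eq, h1] at *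
    simp_all

lemma reg_eq : regularLocus h W ρ W' =
    Set.image (Subtype.val : fixedSpace ρ W' → h × StrongDual ℂ h)
    (compl (V := fixedSpace ρ W') (badSpace ρ W')) := by
  ext p
  constructor
  · intro hp
    exact ⟨⟨p, fun w hw => (hp w).2 hw⟩, fun g hg => g.2 ((hp g.1).1 hg), rfl⟩
  · rintro ⟨q, hq, rfl⟩ g
    exact ⟨fun hg => by_contra fun hn => hq ⟨g, hn⟩ hg, fun hg => q.2 g hg⟩

variable [Finite W]

lemma exists_both (hpar : ∃ vf : h × StrongDual ℂ h, vf ∈ regularLocus h W ρ W')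
    {g : W} (hg : g ∉ W') :
    (∃ v, (∀ w ∈ W', ρ w v = v) ∧ ρ g v ≠ v) ∧
    (∃ f : StrongDual ℂ h, (∀ w ∈ W', ∀ u, f (ρ w⁻¹ u) = f u) ∧ ∃ u, f (ρ g⁻¹ u) ≠ f u) := by
  obtain ⟨⟨v₀, f₀⟩, hp⟩ := hpar
  have hv₀ : ∀ w ∈ W', ρ w v₀ = v₀ := fun w hw => ((hp w).2 hw).1
  have hf₀ : ∀ w ∈ W', ∀ u, f₀ (ρ w⁻¹ u) = f₀ u := fun w hw => ((hp w).2 hw).2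
  have hn : ¬ (ρ g v₀ = v₀ ∧ ∀ u, f₀ (ρ g⁻¹ u) = f₀ u) := fun hh => hg ((hp g).1 hh)
  have hinv : ∀ {f : StrongDual ℂ h}, (∀ w ∈ W', ∀ u, f (ρ w⁻¹ u) = f u) →
      ∀ w ∈ W', ∀ u, f (ρ w u) = f u := fun hf w hw u => by
    simpa using hf w⁻¹ (W'.inv_mem hw) u
  have hsf : ∀ f : StrongDual ℂ h, (∀ w ∈ W', ∀ u, f (ρ w⁻¹ u) = f u) → ∀ u,
      f (sumSub ρ W' u) = Fintype.card W' • f u := by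
    intro f hf u
    rw [sumSub, LinearMap.sum_apply, map_sum,
      Finset.sum_congr rfl (fun w _ => hinv hf w.1 w.2 u)]
    simp
  have hsv : ∀ v, (∀ w ∈ W', ρ w v = v) → sumSub ρ W' v = Fintype.card W' • v := by
    intro v hv
    rw [sumSub, LinearMap.sum_apply, Finset.sum_congr rfl (fun w _ => hv w.1 w.2)]
    simp
  have hright : sumSub ρ W' * ρ g = sumSub ρ W' → ∀ u, f₀ (ρ g⁻¹ u) = f₀ u := by
    intro e u
    refine nsmul_inj (n := Fintype.card W') Fintype.card_ne_zero ?_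
    rw [← hsf f₀ hf₀, ← hsf f₀ hf₀]
    conv_lhs => rw [← e]
    simp
  have hleft : ρ g * sumSub ρ W' = sumSub ρ W' → ρ g v₀ = v₀ := by
    intro e
    refine nsmul_inj (n := Fintype.card W') Fintype.card_ne_zero ?_
    rw [← map_nsmul, ← hsv v₀ hv₀]
    exact LinearMap.congr_fun e v₀
  constructor
  · by_contra! hc
    have e : ρ g * sumSub ρ W' = sumSub ρ W' := by
      ext u
      refine hc _ fun w hw => ?_
      exact LinearMap.congr_fun (mul_sumSub ρ W' hw) u
    exact hn ⟨hleft e, hright (right_of_left ρ W' e)⟩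
  · by_contra! hc
    have e : sumSub ρ W' * ρ g = sumSub ρ W' := by
      ext u
      by_contra hne
      obtain ⟨l, hl⟩ := SeparatingDual.exists_ne_zero (R := ℂ) (sub_ne_zero.2 hne)
      have := hc (l.comp (LinearMap.toContinuousLinearMap (sumSub ρ W'))) (fun w hw u => by
        have := LinearMap.congr_fun (sumSub_mul ρ W' (W'.inv_mem hw)) u
        simp only [Module.End.mul_apply] at this
        simp [this]) (ρ g u)
      apply hl
      simp at this
      simp [this]
    exact hn ⟨hleft (left_of_right ρ W' e), hright e⟩

lemma bad_codim (hpar : ∃ vf : h × StrongDual ℂ h, vf ∈ regularLocus h W ρ W')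
    (g : {g : W // g ∉ W'}) (x y : fixedSpace ρ W') :
    badSpace ρ W' g ⊔ Submodule.span ℝ {x, y} ≠ ⊤ := by
  obtain ⟨⟨v, hv, hgv⟩, f, hf, u, hu⟩ := exists_both ρ W' hpar g.2
  obtain ⟨l, hl⟩ := SeparatingDual.exists_ne_zero (R := ℂ) (sub_ne_zero.2 hgv)
  let Φ : fixedSpace ρ W' →ₗ[ℂ] ℂ × ℂ :=
    { toFun := fun p => (l (ρ g.1 p.1.1 - p.1.1), p.1.2 (ρ g.1⁻¹ u) - p.1.2 u)
      map_add' := by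
        intro a b
        refine Prod.ext ?_ ?_
        · simp; ring
        · simp; ring
      map_smul' := by
        intro c a
        refine Prod.ext ?_ ?_
        · simp; ring
        · simp; ring }
  have hsurj : Function.Surjective Φ := by
    rintro ⟨a, b⟩
    let p : fixedSpace ρ W' := ⟨(v, 0), fun w hw => ⟨hv w hw, by simp⟩⟩
    let q : fixedSpace ρ W' := ⟨(0, f), fun w hw => ⟨by simp, hf w hw⟩⟩
    have hp : Φ p = (l (ρ g.1 v - v), 0) := by simp [Φ, p]
    have hq : Φ q = (0, f (ρ g.1⁻¹ u) - f u) := by simp [Φ, q]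
    refine ⟨(a / l (ρ g.1 v - v)) • p + (b / (f (ρ g.1⁻¹ u) - f u)) • q, ?_⟩
    rw [map_add, map_smul, map_smul, hp, hq]
    have := sub_ne_zero.2 hu
    refine Prod.ext ?_ ?_
    · simp only [Prod.smul_mk, Prod.mk_add_mk, smul_eq_mul, mul_zero, add_zero]
      field_simp
    · simp only [Prod.smul_mk, Prod.mk_add_mk, smul_eq_mul, mul_zero, zero_add]
      field_simp
  let Ψ : fixedSpace ρ W' →ₗ[ℝ] ℂ × ℂ := Φ.restrictScalars ℝ
  have hker : badSpace ρ W' g ≤ LinearMap.ker Ψ := by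
    intro p hp
    have h1 := hp.1
    have h2 := hp.2
    rw [LinearMap.mem_ker]
    change Φ p = 0
    simp [Φ, h1, h2]
  intro htop
  have h1 : Submodule.map Ψ ⊤ = ⊤ := by
    rw [Submodule.map_top, LinearMap.range_eq_top]; exact hsurj
  rw [← htop, Submodule.map_sup, (LinearMap.le_ker_iff_map).1 hker, bot_sup_eq,
    Submodule.map_span, Set.image_pair] at h1
  have h2 := finrank_span_le_card (R := ℝ) ({Ψ x, Ψ y} : Set (ℂ × ℂ))
  rw [h1, finrank_top, Module.finrank_prod, Complex.finrank_real_complex] at h2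
  have h3 : ({Ψ x, Ψ y} : Set (ℂ × ℂ)).toFinset.card ≤ 2 := by
    classical
    simp only [Set.toFinset_insert, Set.toFinset_singleton]
    convert Finset.card_le_two
  omega

lemma simply_reg (hpar : ∃ vf : h × StrongDual ℂ h, vf ∈ regularLocus h W ρ W') :
    SimplyConnectedSpace (regularLocus h W ρ W') := by
  have h1 : IsSimplyConnected (compl (V := fixedSpace ρ W') (badSpace ρ W')) :=
    simplyConnected_compl (V := fixedSpace ρ W') _ (bad_codim ρ W' hpar)
  have h2 := (Topology.IsEmbedding.subtypeVal.isSimplyConnected_image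
    (f := (Subtype.val : fixedSpace ρ W' → h × StrongDual ℂ h))).2 h1
  rw [← reg_eq] at h2
  exact h2

lemma locallyCompact_reg : LocallyCompactSpace (regularLocus h W ρ W') := by
  have : regularLocus h W ρ W' =
      (⋂ g ∈ W', {p | dualPairAction h W ρ g p = p}) ∩
        (⋂ g ∈ (W' : Set W)ᶜ, {p | dualPairAction h W ρ g p = p}ᶜ) := by
    ext p
    rw [mem_reg_iff]
    simp only [Set.mem_inter_iff, Set.mem_iInter, Set.mem_compl_iff, Set.mem_ofPred_eq]
    exact ⟨fun H => ⟨fun g hg => (H g).2 hg, fun g hg e => hg ((H g).1 e)⟩,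
      fun H g => ⟨fun e => by_contra fun hg => H.2 g hg e, H.1 g⟩⟩
  have hcl : ∀ g, IsClosed {p | dualPairAction h W ρ g p = p} := fun g =>
    isClosed_eq (act_continuous ρ g) continuous_id
  have hl : IsLocallyClosed (regularLocus h W ρ W') := by
    rw [this]
    refine IsLocallyClosed.inter (IsClosed.isLocallyClosed ?_) (IsOpen.isLocallyClosed ?_)
    · exact isClosed_biInter fun g _ => hcl g
    · exact (Set.toFinite _).isOpen_biInter fun g _ => (hcl g).isOpen_compl
  haveI : ProperSpace h := FiniteDimensional.proper ℂ h
  haveI : ProperSpace (StrongDual ℂ h) := FiniteDimensional.proper ℂ _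
  exact hl.locallyCompactSpace

/-- The normalizer of the subgroup. -/
abbrev Nz : Subgroup W := Subgroup.normalizer (W' : Set W)

/-- The normalizer acts on the regular locus. -/
@[reducible] def nAction : MulAction (Nz W') (regularLocus h W ρ W') where
  smul g p := ⟨dualPairAction h W ρ g.1 p.1, act_mem ρ W' g.2 p.2⟩
  one_smul p := Subtype.ext (act_one ρ p.1)
  mul_smul a b p := Subtype.ext (act_mul ρ a.1 b.1 p.1)

/-- The quotient homomorphism to permutations. -/
def qHom : (Nz W' ⧸ W'.subgroupOf (Nz W')) →* Equiv.Perm (regularLocus h W ρ W') :=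
  QuotientGroup.lift (W'.subgroupOf (Nz W'))
    (@MulAction.toPermHom (Nz W') (regularLocus h W ρ W') _ (nAction ρ W')) (by
      intro g hg
      ext1 p
      exact Subtype.ext (((mem_reg_iff ρ W' _).1 p.2 g.1).2 hg))

/-- The induced action of the quotient. -/
instance qAction : MulAction (Nz W' ⧸ W'.subgroupOf (Nz W')) (regularLocus h W ρ W') :=
  MulAction.compHom _ (qHom ρ W')

lemma q_smul (g : Nz W') (p : regularLocus h W ρ W') :
    (((QuotientGroup.mk g : Nz W' ⧸ W'.subgroupOf (Nz W')) • p : regularLocus h W ρ W') :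
      h × StrongDual ℂ h) = dualPairAction h W ρ g.1 p.1 := rfl

lemma rel_equiv : Equivalence (normalizerOrbitRel h W ρ W') where
  refl a := ⟨1, one_mem _, act_one ρ _⟩
  symm := by
    rintro a b ⟨g, hg, e⟩
    refine ⟨g⁻¹, inv_mem hg, ?_⟩
    rw [← e, ← act_mul, inv_mul_cancel, act_one]
  trans := by
    rintro a b c ⟨g, hg, e⟩ ⟨k, hk, e'⟩
    exact ⟨k * g, mul_mem hk hg, by rw [act_mul, e, e']⟩

lemma cover : IsQuotientCoveringMap (Quot.mk (normalizerOrbitRel h W ρ W'))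
    (Nz W' ⧸ W'.subgroupOf (Nz W')) := by
  haveI := locallyCompact_reg ρ W'
  haveI : ContinuousConstSMul (Nz W' ⧸ W'.subgroupOf (Nz W')) (regularLocus h W ρ W') := by
    refine ⟨fun g => ?_⟩
    obtain ⟨g, rfl⟩ := QuotientGroup.mk_surjective g
    refine continuous_induced_rng.2 ?_
    exact (act_continuous ρ g.1).comp continuous_subtype_val
  haveI : IsCancelSMul (Nz W' ⧸ W'.subgroupOf (Nz W')) (regularLocus h W ρ W') := by
    rw [isCancelSMul_iff_eq_one_of_smul_eq]
    intro g p hgp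
    obtain ⟨g, rfl⟩ := QuotientGroup.mk_surjective g
    rw [QuotientGroup.eq_one_iff]
    exact ((mem_reg_iff ρ W' _).1 p.2 g.1).1 (congrArg Subtype.val hgp)
  refine Topology.IsQuotientMap.isQuotientCoveringMap_of_properlyDiscontinuousSMul
    isQuotientMap_quot_mk ?_
  intro a b
  have h1 : Quot.mk (normalizerOrbitRel h W ρ W') a = Quot.mk _ b ↔
      normalizerOrbitRel h W ρ W' b a := by
    constructor
    · intro e
      exact (rel_equiv ρ W').symm ((rel_equiv ρ W').eqvGen_iff.1 (Quot.eqvGen_exact e))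
    · intro e
      exact (Quot.sound e).symm
  rw [h1]
  constructor
  · rintro ⟨g, hg, e⟩
    exact ⟨QuotientGroup.mk ⟨g, hg⟩, Subtype.ext e⟩
  · rintro ⟨g, e⟩
    obtain ⟨g, rfl⟩ := QuotientGroup.mk_surjective g
    exact ⟨g.1, g.2, congrArg Subtype.val e⟩

end Rep

end LeafAux

/-- The normalizer `N_W(W′)` preserves `(𝔥 ⊕ 𝔥*)^{W′,W′-reg}`, `W′` acts trivially on it, the
induced action of `N_W(W′)/W′` is free, and the fundamental group of the quotient space
`(𝔥 ⊕ 𝔥*)^{W′,W′-reg} / N_W(W′)` at any basepoint is isomorphic to the finite group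
`N_W(W′)/W′`. -/
theorem fundamentalGroup_of_leaf
    (h : Type) [NormedAddCommGroup h] [NormedSpace ℂ h] [FiniteDimensional ℂ h]
    (W : Type) [Group W] [Finite W] (ρ : Representation ℂ W h) (W' : Subgroup W)
    (hpar : ∃ vf : h × StrongDual ℂ h, vf ∈ regularLocus h W ρ W') :
    (∀ g ∈ Subgroup.normalizer (W' : Set W), ∀ vf ∈ regularLocus h W ρ W',
        dualPairAction h W ρ g vf ∈ regularLocus h W ρ W') ∧
    (∀ g ∈ W', ∀ vf ∈ regularLocus h W ρ W', dualPairAction h W ρ g vf = vf) ∧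
    (∀ g ∈ Subgroup.normalizer (W' : Set W), ∀ vf ∈ regularLocus h W ρ W',
        dualPairAction h W ρ g vf = vf → g ∈ W') ∧
    (∀ x : Quot (normalizerOrbitRel h W ρ W'),
        Nonempty (FundamentalGroup (Quot (normalizerOrbitRel h W ρ W')) x ≃*
          Subgroup.normalizer (W' : Set W) ⧸ W'.subgroupOf (Subgroup.normalizer (W' : Set W)))) := by
  refine ⟨fun g hg vf hvf => LeafAux.act_mem ρ W' hg hvf,
    fun g hg vf hvf => ((LeafAux.mem_reg_iff ρ W' vf).1 hvf g).2 hg,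
    fun g _ vf hvf e => ((LeafAux.mem_reg_iff ρ W' vf).1 hvf g).1 e, fun x => ?_⟩
  haveI := LeafAux.simply_reg ρ W' hpar
  obtain ⟨e, he⟩ := Quot.exists_rep x
  exact ⟨((LeafAux.cover ρ W').fundamentalGroupEquiv ⟨e, he⟩).trans (MulEquiv.inv' _).symm⟩
end
end
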